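/- arXiv:1608.04588 — 2 statements merged into one kernel-verified Lean document; each statement's English description precedes it below -/
import Mathlib

section
/- Let R be a Gorenstein local ring, let a be a Gorenstein ideal of R, and let M be a finitely generated R-module. Then Ext^i_R(M, R/a) = 0 for all i ≫ 0 if and only if Tor_i^R(M, R/a) = 0 for all i ≫ 0. -/
open CategoryTheory CategoryTheory.Limits CategoryTheory.MonoidalCategory Opposite

noncomputable section

universe u

variable (R : Type u) [CommRing R]

/-- Ordinary `Ext` of `R`-modules, via the derived functor `Ext` of Mathlib. -/
abbrev ExtMod (n : ℕ) (M N : ModuleCat.{u} R) : ModuleCat.{u} R :=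
  ((Ext R (ModuleCat.{u} R) n).obj (op M)).obj N

/-- Ordinary `Tor` of `R`-modules, via the derived functor `Tor` of Mathlib. -/
abbrev TorMod (n : ℕ) (M N : ModuleCat.{u} R) : ModuleCat.{u} R :=
  ((Tor (ModuleCat.{u} R) n).obj M).obj N

/-- A finitely generated module `M` is totally reflexive (of G-dimension zero) if the
biduality map is an isomorphism and `Ext^i(M,R) = 0 = Ext^i(M^*,R)` for all `i > 0`. -/
def IsTotallyReflexive (M : ModuleCat.{u} R) : Prop :=
  Module.Finite R M ∧
  Function.Bijective (Module.Dual.eval R M) ∧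
  (∀ i : ℕ, 0 < i → IsZero (ExtMod R i M (ModuleCat.of R R))) ∧
  (∀ i : ℕ, 0 < i → IsZero (ExtMod R i (ModuleCat.of R (Module.Dual R M)) (ModuleCat.of R R)))

/-- `M` admits a resolution `0 → G_n → ⋯ → G_0 → M → 0` by totally reflexive modules. -/
def GDimLE (M : ModuleCat.{u} R) (n : ℕ) : Prop :=
  ∃ (G : ChainComplex (ModuleCat.{u} R) ℕ) (ε : G.X 0 ⟶ M),
    (∀ i, i ≤ n → IsTotallyReflexive R (G.X i)) ∧
    (∀ i, n < i → IsZero (G.X i)) ∧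
    Epi ε ∧
    (∃ w : G.d 1 0 ≫ ε = 0, (ShortComplex.mk (G.d 1 0) ε w).Exact) ∧
    (∀ i, 0 < i → G.ExactAt i)

/-- `M` has finite Gorenstein dimension. -/
def HasFiniteGDim (M : ModuleCat.{u} R) : Prop := ∃ n, GDimLE R M n

/-- The Gorenstein dimension of `M`, as an element of `ℕ∞`. -/
def gdim (M : ModuleCat.{u} R) : ℕ∞ :=
  sInf {c : ℕ∞ | ∃ n : ℕ, c = n ∧ GDimLE R M n}

/-- `M` admits a projective resolution of length at most `n`. -/
def PdLE (M : ModuleCat.{u} R) (n : ℕ) : Prop :=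
  ∃ (G : ChainComplex (ModuleCat.{u} R) ℕ) (ε : G.X 0 ⟶ M),
    (∀ i, Projective (G.X i)) ∧
    (∀ i, n < i → IsZero (G.X i)) ∧
    Epi ε ∧
    (∃ w : G.d 1 0 ≫ ε = 0, (ShortComplex.mk (G.d 1 0) ε w).Exact) ∧
    (∀ i, 0 < i → G.ExactAt i)

/-- `M` has finite projective dimension. -/
def HasFinitePd (M : ModuleCat.{u} R) : Prop := ∃ n, PdLE R M n

/-- The projective dimension of `M`, as an element of `ℕ∞`. -/
def pdim (M : ModuleCat.{u} R) : ℕ∞ :=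
  sInf {c : ℕ∞ | ∃ n : ℕ, c = n ∧ PdLE R M n}

/-- `M` admits an injective resolution `0 → M → I^0 → ⋯ → I^n → 0`. -/
def InjDimLE (M : ModuleCat.{u} R) (n : ℕ) : Prop :=
  ∃ (I : CochainComplex (ModuleCat.{u} R) ℕ) (ι : M ⟶ I.X 0),
    (∀ i, Injective (I.X i)) ∧
    (∀ i, n < i → IsZero (I.X i)) ∧
    Mono ι ∧
    (∃ w : ι ≫ I.d 0 1 = 0, (ShortComplex.mk ι (I.d 0 1) w).Exact) ∧
    (∀ i, 0 < i → I.ExactAt i)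

/-- `M` has finite injective dimension. -/
def HasFiniteInjDim (M : ModuleCat.{u} R) : Prop := ∃ n, InjDimLE R M n

/-- A Gorenstein local ring: a commutative Noetherian local ring of finite self-injective
dimension. -/
def IsGorensteinLocalRing : Prop :=
  IsLocalRing R ∧ IsNoetherianRing R ∧ HasFiniteInjDim R (ModuleCat.of R R)

/-- The grade of a module: `grade M = inf { i | Ext^i(M,R) ≠ 0 }`. -/
def gradeM (M : ModuleCat.{u} R) : ℕ∞ :=
  sInf {c : ℕ∞ | ∃ i : ℕ, c = i ∧ ¬ IsZero (ExtMod R i M (ModuleCat.of R R))}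

/-- A module is G-perfect if its grade equals its Gorenstein dimension. -/
def IsGPerfect (M : ModuleCat.{u} R) : Prop := gradeM R M = gdim R M

/-- An ideal `c` is perfect if `grade (R/c) = pd (R/c)`. -/
def IsPerfectIdeal (c : Ideal R) : Prop :=
  gradeM R (ModuleCat.of R (R ⧸ c)) = pdim R (ModuleCat.of R (R ⧸ c))

/-- A complete resolution `T → P → M` of `M`: `P → M` is a resolution by finite projective
modules, `T` is a totally acyclic complex of finite projective modules, and `θ i` is an
isomorphism for all `i ≫ 0`. -/
structure CompleteResolution (M : ModuleCat.{u} R) where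
  T : ChainComplex (ModuleCat.{u} R) ℤ
  P : ChainComplex (ModuleCat.{u} R) ℤ
  θ : T ⟶ P
  π : P.X 0 ⟶ M
  projT : ∀ i, Projective (T.X i)
  fgT : ∀ i, Module.Finite R (T.X i)
  projP : ∀ i, Projective (P.X i)
  fgP : ∀ i, Module.Finite R (P.X i)
  zeroP : ∀ i : ℤ, i < 0 → IsZero (P.X i)
  epiπ : Epi π
  wπ : P.d 1 0 ≫ π = 0
  exact0 : (ShortComplex.mk (P.d 1 0) π wπ).Exact
  exactP : ∀ i : ℤ, 0 < i → P.ExactAt i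
  exactT : ∀ i : ℤ, T.ExactAt i
  exactTdual : ∀ i : ℤ, (T.linearYonedaObj R (ModuleCat.of R R)).ExactAt i
  iso_eventually : ∃ n₀ : ℤ, ∀ i : ℤ, n₀ ≤ i → IsIso (θ.f i)

/-- Tate cohomology `Êxt^i(M,N) = H^i(Hom(T,N))` computed from a complete resolution of `M`. -/
def TateExt {M : ModuleCat.{u} R} (C : CompleteResolution R M) (N : ModuleCat.{u} R)
    (i : ℤ) : ModuleCat.{u} R :=
  (C.T.linearYonedaObj R N).homology i

/-- Tate homology `T̂or_i(M,N) = H_i(T ⊗ N)` computed from a complete resolution of `M`. -/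
def TateTor {M : ModuleCat.{u} R} (C : CompleteResolution R M) (N : ModuleCat.{u} R)
    (i : ℤ) : ModuleCat.{u} R :=
  ((((tensoringRight (ModuleCat.{u} R)).obj N).mapHomologicalComplex _).obj C.T).homology i

/-- The depth of a module over a local ring: the supremum of the lengths of the
`M`-regular sequences contained in the maximal ideal. -/
def moduleDepth [IsLocalRing R] (M : Type u) [AddCommGroup M] [Module R M] : ℕ∞ :=
  sSup {c : ℕ∞ | ∃ rs : List R, c = rs.length ∧
    (∀ r ∈ rs, r ∈ IsLocalRing.maximalIdeal R) ∧ RingTheory.Sequence.IsRegular M rs}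

/-- `E` is an injective envelope of the residue field `k`: an injective module which is an
essential extension of `k`. -/
def IsInjectiveEnvelopeOfResidueField [IsLocalRing R] (E : Type u) [AddCommGroup E]
    [Module R E] : Prop :=
  Injective (ModuleCat.of R E) ∧
  ∃ ι : IsLocalRing.ResidueField R →ₗ[R] E,
    Function.Injective ι ∧
    ∀ N : Submodule R E, N ≠ ⊥ → N ⊓ LinearMap.range ι ≠ ⊥


/-- A minimal free resolution `⋯ → F_1 → F_0 → M → 0` of a finitely generated module over a
local ring, recorded by its Betti numbers `b n` and differentials with image inside
`m • F_n`. -/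
structure MinFreeRes [IsLocalRing R] (M : Type u) [AddCommGroup M] [Module R M] where
  b : ℕ → ℕ
  d : ∀ n : ℕ, ((Fin (b (n+1)) → R) →ₗ[R] (Fin (b n) → R))
  aug : (Fin (b 0) → R) →ₗ[R] M
  aug_surj : Function.Surjective aug
  exact_zero : LinearMap.ker aug = LinearMap.range (d 0)
  exact_succ : ∀ n, LinearMap.ker (d n) = LinearMap.range (d (n+1))
  minimal : ∀ n, LinearMap.range (d n) ≤ (IsLocalRing.maximalIdeal R) • ⊤

/-- The Betti numbers of `M` are eventually bounded by `γ · n^(c-1)`. -/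
def CxLE [IsLocalRing R] (M : Type u) [AddCommGroup M] [Module R M] (c : ℕ) : Prop :=
  ∃ (F : MinFreeRes R M) (γ : ℝ) (n₀ : ℕ),
    ∀ n : ℕ, n₀ ≤ n → (F.b n : ℝ) ≤ γ * (n : ℝ) ^ ((c : ℤ) - 1)

/-- The complexity of a module: the least `c` such that the Betti numbers are eventually
bounded by `γ · n^(c-1)` for some `γ`. -/
def complexity [IsLocalRing R] (M : Type u) [AddCommGroup M] [Module R M] : ℕ∞ :=
  sInf {e : ℕ∞ | ∃ c : ℕ, e = c ∧ CxLE R M c}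

/-- The pushout `K_η` of a map `f : Ω^{j+1} M → M` (representing a degree-`(j+1)`
homogeneous element `η` of `Ext^*(M,M)`) along the inclusion `Ω^{j+1} M ↪ F_j`: the
cokernel of `(f, -incl) : Ω^{j+1} M → M ⊕ F_j`. -/
abbrev PushoutMod [IsLocalRing R] {M : Type u} [AddCommGroup M] [Module R M]
    (F : MinFreeRes R M) (j : ℕ) (f : LinearMap.range (F.d j) →ₗ[R] M) : Type u :=
  (M × (Fin (F.b j) → R)) ⧸
    LinearMap.range (LinearMap.prod f (-(LinearMap.range (F.d j)).subtype))

/-- Auxiliary predicate: `M` has reducible complexity, with recursion depth `≤ c`. -/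
def RedCxAux [IsLocalRing R] :
    ℕ → ∀ (M : Type u) (_ : AddCommGroup M) (_ : Module R M), Prop
  | 0, M, g, m =>
      letI := g; letI := m
      HasFinitePd R (ModuleCat.of R M)
  | (c+1), M, g, m =>
      letI := g; letI := m
      HasFinitePd R (ModuleCat.of R M) ∨
      (complexity R M < ⊤ ∧ 0 < complexity R M ∧
        ∃ (j : ℕ) (F : MinFreeRes R M) (f : LinearMap.range (F.d j) →ₗ[R] M),
          complexity R (PushoutMod R F j f) < complexity R M ∧
          moduleDepth R (PushoutMod R F j f) = moduleDepth R M ∧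
          RedCxAux c (PushoutMod R F j f) inferInstance inferInstance)

/-- `M` has reducible complexity. -/
def HasReducibleComplexity [IsLocalRing R] (M : Type u) [AddCommGroup M] [Module R M] :
    Prop :=
  ∃ c : ℕ, RedCxAux R c M inferInstance inferInstance

/-- `L` is (isomorphic to) `λ N = Ω Tr N`, computed from a minimal free presentation of `N`
over the local ring `S`. -/
def IsLambdaOf (S : Type u) [CommRing S] [IsLocalRing S]
    (N L : Type u) [AddCommGroup N] [Module S N] [AddCommGroup L] [Module S L] : Prop :=
  ∃ (n₀ n₁ : ℕ) (g : (Fin n₀ → S) →ₗ[S] N) (f : (Fin n₁ → S) →ₗ[S] (Fin n₀ → S)),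
    Function.Surjective g ∧
    LinearMap.range f = LinearMap.ker g ∧
    LinearMap.ker g ≤ (IsLocalRing.maximalIdeal S) • ⊤ ∧
    LinearMap.ker f ≤ (IsLocalRing.maximalIdeal S) • ⊤ ∧
    Nonempty (L ≃ₗ[S] LinearMap.range f.dualMap)

/-- `M` and `N` are linked by the ideal `c`: both are annihilated by `c` (hence are
`R/c`-modules) and `M ≅ λ_{R/c} N`, `N ≅ λ_{R/c} M`. -/
def LinkedBy (c : Ideal R) (M N : Type u) [AddCommGroup M] [Module (R ⧸ c) M]
    [AddCommGroup N] [Module (R ⧸ c) N] [IsLocalRing (R ⧸ c)] : Prop :=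
  IsLambdaOf (R ⧸ c) N M ∧ IsLambdaOf (R ⧸ c) M N


section TorBalance
open TensorProduct

variable {R : Type} [CommRing R]

lemma balance_aux {A B C Q0 Q1 Q2 Q' : Type} [AddCommGroup A] [AddCommGroup B] [AddCommGroup C]
    [AddCommGroup Q0] [AddCommGroup Q1] [AddCommGroup Q2] [AddCommGroup Q']
    [Module R A] [Module R B] [Module R C] [Module R Q0] [Module R Q1] [Module R Q2] [Module R Q']
    [Module.Flat R B] [Module.Flat R Q0] [Module.Flat R Q1] [Module.Flat R Q2]
    (ι : A →ₗ[R] B) (p : B →ₗ[R] C) (hι : Function.Injective ι) (hp : Function.Surjective p)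
    (hex : Function.Exact ι p)
    (e2 : Q2 →ₗ[R] Q1) (e1 : Q1 →ₗ[R] Q0) (e0 : Q0 →ₗ[R] Q')
    (h21 : Function.Exact e2 e1) (h10 : Function.Exact e1 e0) :
    Function.Exact (e2.lTensor C) (e1.lTensor C) ↔
      ∀ x : A ⊗[R] Q0, e0.lTensor B (ι.rTensor Q0 x) = 0 → ∃ y, e1.lTensor A y = x := by
  have c1 : ∀ x, e1.lTensor B (ι.rTensor Q1 x) = ι.rTensor Q0 (e1.lTensor A x) := fun x => by
    rw [← LinearMap.comp_apply, ← LinearMap.comp_apply, LinearMap.lTensor_comp_rTensor,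
      LinearMap.rTensor_comp_lTensor]
  have c2 : ∀ x, e1.lTensor C (p.rTensor Q1 x) = p.rTensor Q0 (e1.lTensor B x) := fun x => by
    rw [← LinearMap.comp_apply, ← LinearMap.comp_apply, LinearMap.lTensor_comp_rTensor,
      LinearMap.rTensor_comp_lTensor]
  have c3 : ∀ x, e2.lTensor C (p.rTensor Q2 x) = p.rTensor Q1 (e2.lTensor B x) := fun x => by
    rw [← LinearMap.comp_apply, ← LinearMap.comp_apply, LinearMap.lTensor_comp_rTensor,
      LinearMap.rTensor_comp_lTensor]
  have i0 := Module.Flat.rTensor_preserves_injective_linearMap (M := Q0) ι hι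
  have x0 := rTensor_exact Q0 hex hp
  have x1 := rTensor_exact Q1 hex hp
  have s1 := LinearMap.rTensor_surjective Q1 hp
  have s2 := LinearMap.rTensor_surjective Q2 hp
  have b21 := Module.Flat.lTensor_exact B h21
  have b10 := Module.Flat.lTensor_exact B h10
  constructor
  · intro H x hx
    obtain ⟨z, hz⟩ := (b10 _).1 hx
    have : e1.lTensor C (p.rTensor Q1 z) = 0 := by
      rw [c2, hz]; exact x0.apply_apply_eq_zero x
    obtain ⟨w, hw⟩ := (H _).1 this
    obtain ⟨w', rfl⟩ := s2 w
    rw [c3] at hw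
    obtain ⟨y, hy⟩ := (x1 (z - e2.lTensor B w')).1 (by rw [map_sub, hw, sub_self])
    refine ⟨y, i0 ?_⟩
    rw [← c1, hy, map_sub, hz, b21.apply_apply_eq_zero, sub_zero]
  · intro H m
    constructor
    · intro hm
      obtain ⟨z, rfl⟩ := s1 m
      rw [c2] at hm
      obtain ⟨x, hx⟩ := (x0 _).1 hm
      obtain ⟨y, rfl⟩ := H x (by rw [hx]; exact b10.apply_apply_eq_zero z)
      rw [← c1] at hx
      obtain ⟨w, hw⟩ := (b21 (z - ι.rTensor Q1 y)).1 (by rw [map_sub, hx, sub_self])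
      refine ⟨p.rTensor Q2 w, ?_⟩
      rw [c3, hw, map_sub, x1.apply_apply_eq_zero, sub_zero]
    · rintro ⟨w, rfl⟩
      obtain ⟨w', rfl⟩ := s2 w
      rw [c3, c2, b21.apply_apply_eq_zero, map_zero]

variable {A B C : Type} [AddCommGroup A] [AddCommGroup B] [AddCommGroup C]
    [Module R A] [Module R B] [Module R C] [Module.Flat R B]
    (ι : A →ₗ[R] B) (p : B →ₗ[R] C)
    {Q : ℕ → Type} [∀ k, AddCommGroup (Q k)] [∀ k, Module R (Q k)] [∀ k, Module.Flat R (Q k)]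
    (e : ∀ k, Q (k+1) →ₗ[R] Q k)

lemma balance_shift (hι : Function.Injective ι) (hp : Function.Surjective p)
    (hex : Function.Exact ι p)
    (he : ∀ k, Function.Exact (e (k+1)) (e k)) (k : ℕ) :
    Function.Exact ((e (k+2)).lTensor C) ((e (k+1)).lTensor C) ↔
    Function.Exact ((e (k+1)).lTensor A) ((e k).lTensor A) := by
  rw [balance_aux ι p hι hp hex _ _ (e k) (he _) (he _)]
  have i0 := Module.Flat.rTensor_preserves_injective_linearMap (M := Q k) ι hι
  have c1 : ∀ x, (e k).lTensor B (ι.rTensor _ x) = ι.rTensor _ ((e k).lTensor A x) := fun x => by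
    rw [← LinearMap.comp_apply, ← LinearMap.comp_apply, LinearMap.lTensor_comp_rTensor,
      LinearMap.rTensor_comp_lTensor]
  constructor
  · intro H x
    refine ⟨fun hx => H x (by rw [c1, hx, map_zero]), ?_⟩
    rintro ⟨y, rfl⟩
    rw [← LinearMap.comp_apply, ← LinearMap.lTensor_comp, (he k).linearMap_comp_eq_zero]
    simp
  · intro H x hx
    exact (H x).1 (i0 (by rw [← c1, hx, map_zero]))

variable {S : Type} [AddCommGroup S] [Module R S] (ε : Q 0 →ₗ[R] S)

lemma balance_base (hι : Function.Injective ι) (hp : Function.Surjective p)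
    (hex : Function.Exact ι p)
    (he : ∀ k, Function.Exact (e (k+1)) (e k)) (hε : Function.Surjective ε)
    (hε' : Function.Exact (e 0) ε) :
    Function.Exact ((e 1).lTensor C) ((e 0).lTensor C) ↔ Function.Injective (ι.rTensor S) := by
  rw [balance_aux ι p hι hp hex _ _ ε (he _) hε']
  have c1 : ∀ x, ε.lTensor B (ι.rTensor _ x) = ι.rTensor _ (ε.lTensor A x) := fun x => by
    rw [← LinearMap.comp_apply, ← LinearMap.comp_apply, LinearMap.lTensor_comp_rTensor,
      LinearMap.rTensor_comp_lTensor]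
  have x0 := lTensor_exact A hε' hε
  have s0 := LinearMap.lTensor_surjective A hε
  constructor
  · intro H
    rw [injective_iff_map_eq_zero]
    intro x hx
    obtain ⟨y, rfl⟩ := s0 x
    exact (x0 _).2 (H y (by rw [c1, hx]))
  · intro H x hx
    rw [c1] at hx
    exact (x0 _).1 (H (by rw [hx, map_zero]))

lemma balance_end {D : Type} [AddCommGroup D] [Module R D] {G : Type} [AddCommGroup G] [Module R G]
    (d' : D →ₗ[R] G) (q : G →ₗ[R] A) (hq : Function.Surjective q) (hdq : Function.Exact d' q) :
    Function.Injective (ι.rTensor S) ↔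
      Function.Exact (d'.rTensor S) ((ι ∘ₗ q).rTensor S) := by
  have x0 := rTensor_exact S hdq hq
  have s0 := LinearMap.rTensor_surjective S hq
  rw [LinearMap.rTensor_comp]
  constructor
  · intro H x
    rw [← x0 x, LinearMap.comp_apply]
    exact map_eq_zero_iff _ H
  · intro H
    rw [injective_iff_map_eq_zero]
    intro x hx
    obtain ⟨y, rfl⟩ := s0 x
    exact (x0 _).2 ((H y).1 hx)

/-- balancing of Tor, phrased as an equivalence of exactness statements -/
lemma balance {M : Type} [AddCommGroup M] [Module R M]
    {F : ℕ → Type} [∀ k, AddCommGroup (F k)] [∀ k, Module R (F k)] [∀ k, Module.Flat R (F k)]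
    (d : ∀ k, F (k+1) →ₗ[R] F k) (hd : ∀ k, Function.Exact (d (k+1)) (d k))
    (π : F 0 →ₗ[R] M) (hπ : Function.Surjective π) (hπ' : Function.Exact (d 0) π)
    {Q : ℕ → Type} [∀ k, AddCommGroup (Q k)] [∀ k, Module R (Q k)] [∀ k, Module.Flat R (Q k)]
    (e : ∀ k, Q (k+1) →ₗ[R] Q k) (he : ∀ k, Function.Exact (e (k+1)) (e k))
    {S : Type} [AddCommGroup S] [Module R S] (ε : Q 0 →ₗ[R] S) (hε : Function.Surjective ε)
    (hε' : Function.Exact (e 0) ε) (k : ℕ) :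
    Function.Exact ((e (k+1)).lTensor M) ((e k).lTensor M) ↔
      Function.Exact ((d (k+1)).rTensor S) ((d k).rTensor S) := by
  have hι : Function.Injective (LinearMap.range (d 0)).subtype := Subtype.val_injective
  have hex : Function.Exact (LinearMap.range (d 0)).subtype π := by
    rw [LinearMap.exact_iff, Submodule.range_subtype]; exact LinearMap.exact_iff.1 hπ'
  have hq : Function.Exact (d 1) (d 0).rangeRestrict := by
    rw [LinearMap.exact_iff, LinearMap.ker_rangeRestrict]; exact LinearMap.exact_iff.1 (hd 0)
  induction k generalizing M F with
  | zero =>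
    rw [balance_base (LinearMap.range (d 0)).subtype π e ε hι hπ hex he hε hε',
      balance_end _ (d 1) (d 0).rangeRestrict (LinearMap.surjective_rangeRestrict _) hq]
    rfl
  | succ k ih =>
    rw [balance_shift (LinearMap.range (d 0)).subtype π e hι hπ hex he]
    exact @ih (LinearMap.range (d 0)) _ _ (fun k => F (k+1)) _ _ _ (fun k => d (k+1))
      (fun k => hd (k+1)) (d 0).rangeRestrict (LinearMap.surjective_rangeRestrict _) hq
      Subtype.val_injective
      (by rw [LinearMap.exact_iff, Submodule.range_subtype]; exact LinearMap.exact_iff.1 hq)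
      (by rw [LinearMap.exact_iff, LinearMap.ker_rangeRestrict]; exact LinearMap.exact_iff.1 (hd 1))

end TorBalance

section InjDim

variable {S : Type} [CommRing S]

lemma injd_step {N I N' W3 W2 W1 W0 : Type} [AddCommGroup N] [AddCommGroup I] [AddCommGroup N']
    [AddCommGroup W3] [AddCommGroup W2] [AddCommGroup W1] [AddCommGroup W0]
    [Module S N] [Module S I] [Module S N'] [Module S W3] [Module S W2] [Module S W1] [Module S W0]
    [Module.Injective S I] [Module.Projective S W0]
    (ι : N →ₗ[S] I) (p : I →ₗ[S] N') (hι : Function.Injective ι) (hp : Function.Surjective p)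
    (hex : Function.Exact ι p)
    (a : W3 →ₗ[S] W2) (b : W2 →ₗ[S] W1) (c : W1 →ₗ[S] W0)
    (hab : Function.Exact a b) (hbc : c ∘ₗ b = 0)
    (H : ∀ g : W1 →ₗ[S] N', g ∘ₗ b = 0 → ∃ h : W0 →ₗ[S] N', h ∘ₗ c = g)
    (f : W2 →ₗ[S] N) (hf : f ∘ₗ a = 0) : ∃ g : W1 →ₗ[S] N, g ∘ₗ b = f := by
  have hker : LinearMap.ker b ≤ LinearMap.ker (ι ∘ₗ f) := by
    intro x hx
    obtain ⟨y, rfl⟩ := (hab x).1 hx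
    have : f (a y) = 0 := LinearMap.congr_fun hf y
    simp [this]
  let f' : (W2 ⧸ LinearMap.ker b) →ₗ[S] I := (LinearMap.ker b).liftQ (ι ∘ₗ f) hker
  let b' : (W2 ⧸ LinearMap.ker b) →ₗ[S] W1 := (LinearMap.ker b).liftQ b le_rfl
  have hb' : Function.Injective b' := by
    rw [← LinearMap.ker_eq_bot]; exact Submodule.ker_liftQ_eq_bot _ _ _ le_rfl
  obtain ⟨g, hg⟩ := Module.Injective.out b' hb' f'
  have hg' : ∀ x, g (b x) = ι (f x) := fun x => hg (Submodule.Quotient.mk x)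
  obtain ⟨h', hh'⟩ := H (p ∘ₗ g) (by
    ext x; simp [hg', hex.apply_apply_eq_zero])
  obtain ⟨h, hh⟩ := Module.projective_lifting_property p h' hp
  have key : ∀ w, g w - h (c w) ∈ LinearMap.range ι := fun w => by
    rw [← LinearMap.exact_iff.1 hex, LinearMap.mem_ker, map_sub]
    have h1 := LinearMap.congr_fun hh' w
    have h2 := LinearMap.congr_fun hh (c w)
    simp only [LinearMap.comp_apply] at h1 h2
    rw [h2, h1, sub_self]
  let r : W1 →ₗ[S] LinearMap.range ι := LinearMap.codRestrict _ (g - h ∘ₗ c) key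
  refine ⟨(LinearEquiv.ofInjective ι hι).symm.toLinearMap ∘ₗ r, ?_⟩
  ext x
  simp only [LinearMap.comp_apply, LinearEquiv.coe_coe, LinearEquiv.symm_apply_eq]
  ext
  have h3 := LinearMap.congr_fun hbc x
  simp only [LinearMap.comp_apply, LinearMap.zero_apply] at h3
  simp [r, hg', h3]

/-- vanishing property for decreasing complexes -/
def PDec (S : Type) [CommRing S] (d : ℕ) (N : Type) [AddCommGroup N] [Module S N] : Prop :=
  ∀ (X : ℕ → Type) [∀ k, AddCommGroup (X k)] [∀ k, Module S (X k)]
    [∀ k, Module.Projective S (X k)]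
    (D : ∀ k, X (k+1) →ₗ[S] X k), (∀ k, Function.Exact (D (k+1)) (D k)) →
    ∀ (m : ℕ) (f : X (m+d+1) →ₗ[S] N), f ∘ₗ D (m+d+1) = 0 →
      ∃ g : X (m+d) →ₗ[S] N, g ∘ₗ D (m+d) = f

/-- vanishing property for increasing complexes -/
def PInc (S : Type) [CommRing S] (d : ℕ) (N : Type) [AddCommGroup N] [Module S N] : Prop :=
  ∀ (X : ℕ → Type) [∀ k, AddCommGroup (X k)] [∀ k, Module S (X k)]
    [∀ k, Module.Projective S (X k)]
    (D : ∀ k, X k →ₗ[S] X (k+1)), (∀ k, Function.Exact (D k) (D (k+1))) →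
    ∀ (m : ℕ) (f : X (m+1) →ₗ[S] N), f ∘ₗ D m = 0 →
      ∃ g : X (m+2) →ₗ[S] N, g ∘ₗ D (m+1) = f

section
variable {N I N' : Type} [AddCommGroup N] [AddCommGroup I] [AddCommGroup N']
    [Module S N] [Module S I] [Module S N'] [Module.Injective S I]
    (ι : N →ₗ[S] I) (p : I →ₗ[S] N')

lemma PDec_succ (hι : Function.Injective ι) (hp : Function.Surjective p)
    (hex : Function.Exact ι p)
    (d : ℕ) (h : PDec S d N') : PDec S (d+1) N := by
  intro X _ _ _ D hD m f hf
  exact injd_step ι p hι hp hex (D (m+d+1+1)) (D (m+d+1)) (D (m+d)) (hD _)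
    (hD _).linearMap_comp_eq_zero (fun g hg => h X D hD m g hg) f hf

lemma PInc_succ (hι : Function.Injective ι) (hp : Function.Surjective p)
    (hex : Function.Exact ι p)
    (d : ℕ) (h : PInc S d N') : PInc S (d+1) N := by
  intro X _ _ _ D hD m f hf
  exact injd_step ι p hι hp hex (D m) (D (m+1)) (D (m+2)) (hD _)
    (hD _).linearMap_comp_eq_zero (fun g hg => h X D hD (m+1) g hg) f hf
end

lemma PDec_PInc_of_res {N : Type} [AddCommGroup N] [Module S N]
    {I : ℕ → Type} [∀ k, AddCommGroup (I k)] [∀ k, Module S (I k)] [∀ k, Module.Injective S (I k)]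
    (ι : N →ₗ[S] I 0) (hι : Function.Injective ι)
    (δ : ∀ k, I k →ₗ[S] I (k+1)) (h0 : Function.Exact ι (δ 0))
    (hδ : ∀ k, Function.Exact (δ k) (δ (k+1))) (n : ℕ) (hn : ∀ k, n < k → Subsingleton (I k)) :
    PDec S (n+1) N ∧ PInc S (n+1) N := by
  have hr : ∀ k, LinearMap.range (δ k) = LinearMap.ker (δ (k+1)) := fun k =>
    (LinearMap.exact_iff.1 (hδ k)).symm
  have key : ∀ j k, j + k = n → PDec S j (LinearMap.range (δ k)) ∧
      PInc S j (LinearMap.range (δ k)) := by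
    intro j
    induction j with
    | zero =>
      intro k hk
      have := hn (k+1) (by omega)
      constructor
      · intro X _ _ _ D hD m f hf
        exact ⟨0, LinearMap.ext fun x => Subsingleton.elim _ _⟩
      · intro X _ _ _ D hD m f hf
        exact ⟨0, LinearMap.ext fun x => Subsingleton.elim _ _⟩
    | succ j ih =>
      intro k hk
      obtain ⟨h1, h2⟩ := ih (k+1) (by omega)
      have hex : Function.Exact (LinearMap.range (δ k)).subtype (δ (k+1)).rangeRestrict := by
        rw [LinearMap.exact_iff, LinearMap.ker_rangeRestrict, Submodule.range_subtype, hr]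
      exact ⟨PDec_succ _ _ Subtype.val_injective (LinearMap.surjective_rangeRestrict _) hex _ h1,
        PInc_succ _ _ Subtype.val_injective (LinearMap.surjective_rangeRestrict _) hex _ h2⟩
  obtain ⟨h1, h2⟩ := key n 0 (by omega)
  have hex : Function.Exact ι (δ 0).rangeRestrict := by
    rw [LinearMap.exact_iff, LinearMap.ker_rangeRestrict]; exact LinearMap.exact_iff.1 h0
  exact ⟨PDec_succ _ _ hι (LinearMap.surjective_rangeRestrict _) hex _ h1,
        PInc_succ _ _ hι (LinearMap.surjective_rangeRestrict _) hex _ h2⟩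

lemma dual_exact_iff (d : ℕ) (h1 : PDec S d S) (h2 : PInc S d S)
    {G : ℕ → Type} [∀ k, AddCommGroup (G k)] [∀ k, Module S (G k)]
    [∀ k, Module.Projective S (G k)] [∀ k, Module.Finite S (G k)]
    (D : ∀ k, G (k+1) →ₗ[S] G k) (hD : ∀ k, D k ∘ₗ D (k+1) = 0) :
    (∃ n, ∀ k, n ≤ k → Function.Exact (D k).dualMap (D (k+1)).dualMap) ↔
    (∃ n, ∀ k, n ≤ k → Function.Exact (D (k+1)) (D k)) := by
  constructor
  · rintro ⟨n, hn⟩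
    refine ⟨n, fun k hk x => ⟨fun hx => ?_, ?_⟩⟩
    · obtain ⟨m, rfl⟩ := Nat.exists_eq_add_of_le hk
      obtain ⟨g, hg⟩ := h2 (fun k => Module.Dual S (G (n+k))) (fun k => (D (n+k)).dualMap)
        (fun k => hn (n+k) (by omega)) m (Module.Dual.eval S _ x)
        (by ext φ; simp [hx])
      obtain ⟨y, rfl⟩ := (Module.evalEquiv S (G (n+(m+2)))).surjective g
      refine ⟨y, ?_⟩
      apply (Module.bijective_dual_eval S (G (n+(m+1)))).1
      rw [← hg]
      ext φ
      simp
      rfl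
    · rintro ⟨y, rfl⟩
      exact LinearMap.congr_fun (hD k) y
  · rintro ⟨n, hn⟩
    refine ⟨n+d, fun k hk f => ⟨fun hf => ?_, ?_⟩⟩
    · obtain ⟨m, rfl⟩ := Nat.exists_eq_add_of_le hk
      obtain ⟨m', hm'⟩ : ∃ m', m' = n + m := ⟨_, rfl⟩
      have : n + d + m = n + (m + d) := by omega
      revert f
      rw [this]
      intro f hf
      obtain ⟨g, hg⟩ := h1 (fun k => G (n+k)) (fun k => D (n+k))
        (fun k => hn (n+k) (by omega)) m f hf
      exact ⟨g, hg⟩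
    · rintro ⟨g, rfl⟩
      ext x
      simpa using congrArg g (LinearMap.congr_fun (hD k) x)

end InjDim

section Res
variable {R : Type} [CommRing R] [IsNoetherianRing R]

lemma exists_free_res_step (R : Type) [CommRing R] (K : Type) [AddCommGroup K] [Module R K]
    [Module.Finite R K] :
    ∃ (n : ℕ) (f : (Fin n → R) →ₗ[R] K), Function.Surjective f := Module.Finite.exists_fin' R K

structure FGM (R : Type) [CommRing R] where
  K : Type
  [g : AddCommGroup K]
  [m : Module R K]
  [fin : Module.Finite R K]

attribute [instance] FGM.g FGM.m FGM.fin

def FGM.n (A : FGM R) : ℕ := (exists_free_res_step R A.K).choose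
def FGM.π (A : FGM R) : (Fin A.n → R) →ₗ[R] A.K := (exists_free_res_step R A.K).choose_spec.choose
lemma FGM.π_surj (A : FGM R) : Function.Surjective A.π :=
  (exists_free_res_step R A.K).choose_spec.choose_spec
def FGM.next (A : FGM R) : FGM R := { K := LinearMap.ker A.π }
def FGM.seq (A : FGM R) : ℕ → FGM R
  | 0 => A
  | k+1 => (A.seq k).next

def FGM.F (A : FGM R) (k : ℕ) : Type := Fin (A.seq k).n → R
instance (A : FGM R) (k : ℕ) : AddCommGroup (A.F k) := inferInstanceAs (AddCommGroup (Fin _ → R))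
instance (A : FGM R) (k : ℕ) : Module R (A.F k) := inferInstanceAs (Module R (Fin _ → R))
instance (A : FGM R) (k : ℕ) : Module.Free R (A.F k) := inferInstanceAs (Module.Free R (Fin _ → R))
instance (A : FGM R) (k : ℕ) : Module.Finite R (A.F k) :=
  inferInstanceAs (Module.Finite R (Fin _ → R))

def FGM.d (A : FGM R) (k : ℕ) : A.F (k+1) →ₗ[R] A.F k :=
  (LinearMap.ker (A.seq k).π).subtype ∘ₗ (A.seq (k+1)).π

lemma FGM.range_d (A : FGM R) (k : ℕ) :
    LinearMap.range (A.d k) = LinearMap.ker (A.seq k).π := by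
  ext x
  constructor
  · rintro ⟨y, rfl⟩
    exact ((A.seq (k+1)).π y).2
  · intro hx
    obtain ⟨y, hy⟩ := (A.seq (k+1)).π_surj ⟨x, hx⟩
    exact ⟨y, congrArg Subtype.val hy⟩

lemma FGM.exact_zero (A : FGM R) : Function.Exact (A.d 0) A.π :=
  LinearMap.exact_iff.2 (A.range_d 0).symm

lemma FGM.exact_succ (A : FGM R) (k : ℕ) : Function.Exact (A.d (k+1)) (A.d k) := by
  rw [LinearMap.exact_iff, A.range_d (k+1)]
  ext x
  exact ⟨fun hx => Subtype.ext hx, fun hx => congrArg Subtype.val hx⟩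

def FGM.complex (A : FGM R) : ChainComplex (ModuleCat.{0} R) ℕ :=
  ChainComplex.of (fun k => ModuleCat.of R (A.F k)) (fun k => ModuleCat.ofHom (A.d k))
    (fun k => by
      ext1
      exact (A.exact_succ k).linearMap_comp_eq_zero)

lemma FGM.complex_d (A : FGM R) (k : ℕ) : A.complex.d (k+1) k = ModuleCat.ofHom (A.d k) := by
  exact ChainComplex.of_d (fun k => ModuleCat.of R (A.F k)) (fun k => ModuleCat.ofHom (A.d k)) k

lemma FGM.exactAt (A : FGM R) (k : ℕ) : A.complex.ExactAt (k+1) := by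
  rw [HomologicalComplex.exactAt_iff' _ (k + 1 + 1) (k + 1) k (by simp) (by simp),
    ShortComplex.ShortExact.moduleCat_exact_iff_function_exact]
  simp only [HomologicalComplex.shortComplexFunctor'_obj_f,
    HomologicalComplex.shortComplexFunctor'_obj_g, FGM.complex_d]
  exact A.exact_succ k

def FGM.res (A : FGM R) : ProjectiveResolution (ModuleCat.of R A.K) where
  complex := A.complex
  projective n := by
    have : Module.Projective R (A.F n) := inferInstance
    exact (IsProjective.iff_projective (A.F n)).1 this
  π := (ChainComplex.toSingle₀Equiv _ _).symm ⟨ModuleCat.ofHom A.π, by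
    rw [A.complex_d]
    ext1
    exact A.exact_zero.linearMap_comp_eq_zero⟩
  quasiIso := ⟨fun n => by
    cases n
    · rw [ChainComplex.quasiIsoAt₀_iff, ShortComplex.quasiIso_iff_of_zeros']
      · constructor
        · rw [ShortComplex.ShortExact.moduleCat_exact_iff_function_exact]
          have h := A.exact_zero
          have h2 := A.complex_d 0
          change Function.Exact (A.complex.d 1 0).hom A.π
          rw [h2]
          exact h
        · exact (ModuleCat.epi_iff_surjective _).2 A.π_surj
      all_goals rfl
    · rw [quasiIsoAt_iff_exactAt']
      · apply FGM.exactAt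
      · apply ChainComplex.exactAt_succ_single_obj⟩
end Res

section Conv
variable {R : Type} [CommRing R]

lemma isZero_ext_iff {M N : ModuleCat.{0} R} (P : ProjectiveResolution M) (k : ℕ) :
    IsZero (((Ext R (ModuleCat.{0} R) (k+1)).obj (op M)).obj N) ↔
    Function.Exact (fun f : P.complex.X k →ₗ[R] N => f ∘ₗ (P.complex.d (k+1) k).hom)
      (fun f : P.complex.X (k+1) →ₗ[R] N => f ∘ₗ (P.complex.d (k+2) (k+1)).hom) := by
  rw [(P.isoExt (R := R) (k+1) N).isZero_iff, ← HomologicalComplex.exactAt_iff_isZero_homology,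
    HomologicalComplex.exactAt_iff' _ k (k + 1) (k+2) (by simp) (by simp),
    ShortComplex.ShortExact.moduleCat_exact_iff_function_exact]
  constructor
  · intro h f
    constructor
    · intro hf
      obtain ⟨g, hg⟩ := (h (ModuleCat.ofHom f)).1 (ModuleCat.hom_ext hf)
      exact ⟨g.hom, congrArg ModuleCat.Hom.hom hg⟩
    · rintro ⟨g, rfl⟩
      exact congrArg ModuleCat.Hom.hom ((h _).2 ⟨ModuleCat.ofHom g, rfl⟩)
  · intro h f
    constructor
    · intro hf
      obtain ⟨g, hg⟩ := (h f.hom).1 (congrArg ModuleCat.Hom.hom hf)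
      exact ⟨ModuleCat.ofHom g, ModuleCat.hom_ext hg⟩
    · rintro ⟨g, rfl⟩
      exact ModuleCat.hom_ext ((h _).2 ⟨g.hom, rfl⟩)

lemma isZero_tor_iff {M N : ModuleCat.{0} R} (P : ProjectiveResolution N) (k : ℕ) :
    IsZero (((Tor (ModuleCat.{0} R) (k+1)).obj M).obj N) ↔
    Function.Exact ((P.complex.d (k+2) (k+1)).hom.lTensor M)
      ((P.complex.d (k+1) k).hom.lTensor M) := by
  rw [show ((Tor (ModuleCat.{0} R) (k+1)).obj M).obj N =
    (((tensoringLeft (ModuleCat.{0} R)).obj M).leftDerived (k+1)).obj N from rfl,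
    (P.isoLeftDerivedObj _ (k+1)).isZero_iff]
  erw [← HomologicalComplex.exactAt_iff_isZero_homology]
  rw [HomologicalComplex.exactAt_iff' _ (k+2) (k + 1) k (by simp) (by simp),
    ShortComplex.ShortExact.moduleCat_exact_iff_function_exact]
  rfl

end Conv

section Final
open TensorProduct

lemma baseChange_dual_exact_iff {R S : Type} [CommRing R] [CommRing S] [Algebra R S]
    {A B C : Type} [AddCommGroup A] [AddCommGroup B] [AddCommGroup C]
    [Module R A] [Module R B] [Module R C] (d1 : A →ₗ[R] B) (d0 : B →ₗ[R] C) :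
    Function.Exact (fun f : C →ₗ[R] S => f ∘ₗ d0) (fun f : B →ₗ[R] S => f ∘ₗ d1) ↔
    Function.Exact (d0.baseChange S).dualMap (d1.baseChange S).dualMap := by
  have key : ∀ {A B : Type} [AddCommGroup A] [AddCommGroup B] [Module R A] [Module R B]
      (d : A →ₗ[R] B) (f : B →ₗ[R] S), (d.baseChange S).dualMap (LinearMap.liftBaseChangeEquiv S f)
        = LinearMap.liftBaseChangeEquiv S (f ∘ₗ d) := by
    intro A B _ _ _ _ d f
    ext x
    simp
  constructor
  · intro h f
    obtain ⟨f, rfl⟩ := (LinearMap.liftBaseChangeEquiv S).surjective f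
    rw [key, LinearEquiv.map_eq_zero_iff]
    refine (h f).trans ⟨?_, ?_⟩
    · rintro ⟨g, rfl⟩
      exact ⟨LinearMap.liftBaseChangeEquiv S g, key _ _⟩
    · rintro ⟨g, hg⟩
      obtain ⟨g, rfl⟩ := (LinearMap.liftBaseChangeEquiv S).surjective g
      rw [key] at hg
      exact ⟨g, (LinearMap.liftBaseChangeEquiv S).injective hg⟩
  · intro h f
    have := h (LinearMap.liftBaseChangeEquiv S f)
    rw [key, LinearEquiv.map_eq_zero_iff] at this
    refine this.trans ⟨?_, ?_⟩
    · rintro ⟨g, hg⟩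
      obtain ⟨g, rfl⟩ := (LinearMap.liftBaseChangeEquiv S).surjective g
      rw [key] at hg
      exact ⟨g, (LinearMap.liftBaseChangeEquiv S).injective hg⟩
    · rintro ⟨g, rfl⟩
      exact ⟨LinearMap.liftBaseChangeEquiv S g, key _ _⟩

lemma injDim_PDec_PInc {S : Type} [CommRing S] (h : HasFiniteInjDim S (ModuleCat.of S S)) :
    ∃ d, PDec S d S ∧ PInc S d S := by
  obtain ⟨n, I, ι, hI, hz, hm, ⟨w, hw⟩, hex⟩ := h
  have : ∀ k, Module.Injective S (I.X k) := fun k =>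
    (Module.injective_iff_injective_object S (I.X k)).2 (hI k)
  refine ⟨n+1, PDec_PInc_of_res (I := fun k => I.X k) ι.hom
    ((ModuleCat.mono_iff_injective _).1 hm) (fun k => (I.d k (k+1)).hom) ?_ ?_ n ?_⟩
  · exact (ShortComplex.ShortExact.moduleCat_exact_iff_function_exact _).1 hw
  · intro k
    have := hex (k+1) (by omega)
    rw [HomologicalComplex.exactAt_iff' _ k (k + 1) (k+2) (by simp) (by simp),
      ShortComplex.ShortExact.moduleCat_exact_iff_function_exact] at this
    exact this
  · intro k hk
    exact ModuleCat.subsingleton_of_isZero (hz k hk)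

lemma eventually_shift (p q : ℕ → Prop) (h : ∀ k, p (k+1) ↔ q k) :
    (∃ n, ∀ i, n ≤ i → p i) ↔ ∃ n, ∀ i, n ≤ i → q i := by
  constructor
  · rintro ⟨n, hn⟩
    exact ⟨n, fun i hi => (h i).1 (hn _ (by omega))⟩
  · rintro ⟨n, hn⟩
    refine ⟨n+1, fun i hi => ?_⟩
    obtain ⟨j, rfl⟩ := Nat.exists_eq_add_of_le' (show 1 ≤ i by omega)
    exact (h j).2 (hn _ (by omega))

lemma isZero_ext_iff' {R S : Type} [CommRing R] [IsNoetherianRing R] [CommRing S] [Algebra R S]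
    (A : FGM R) (k : ℕ) :
    IsZero (ExtMod R (k+1) (ModuleCat.of R A.K) (ModuleCat.of R S)) ↔
      Function.Exact ((A.d k).baseChange S).dualMap ((A.d (k+1)).baseChange S).dualMap := by
  rw [← baseChange_dual_exact_iff]
  refine (isZero_ext_iff A.res k).trans ?_
  have h1 := A.complex_d k
  have h2 := A.complex_d (k+1)
  change Function.Exact (fun f : A.F k →ₗ[R] S => f ∘ₗ (A.complex.d (k+1) k).hom)
      (fun f : A.F (k+1) →ₗ[R] S => f ∘ₗ (A.complex.d (k+2) (k+1)).hom) ↔ _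
  rw [h1, h2]
  rfl

lemma isZero_tor_iff' {R S : Type} [CommRing R] [IsNoetherianRing R] [CommRing S] [Algebra R S]
    (A : FGM R) (k : ℕ) :
    IsZero (TorMod R (k+1) (ModuleCat.of R A.K) (ModuleCat.of R S)) ↔
      Function.Exact ((A.d (k+1)).baseChange S) ((A.d k).baseChange S) := by
  let P := ProjectiveResolution.of (ModuleCat.of R S)
  refine (isZero_tor_iff P k).trans ?_
  have hfl : ∀ k, Module.Flat R (P.complex.X k) := fun k => by
    have : Module.Projective R (P.complex.X k) :=
      (IsProjective.iff_projective (P.complex.X k)).2 (P.projective k)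
    infer_instance
  refine (balance A.d A.exact_succ A.π A.π_surj A.exact_zero (Q := fun k => P.complex.X k)
    (fun k => (P.complex.d (k+1) k).hom)
    (fun k => (ShortComplex.ShortExact.moduleCat_exact_iff_function_exact _).1 (P.exact_succ k))
    (S := S) (P.π.f 0).hom
    ((ModuleCat.epi_iff_surjective (P.π.f 0)).1 inferInstance)
    ((ShortComplex.ShortExact.moduleCat_exact_iff_function_exact _).1 P.exact₀) k).trans ?_
  exact LinearMap.rTensor_exact_iff_lTensor_exact _

end Final

/-- Let `R` be a Gorenstein local ring, `a` a Gorenstein ideal of `R`, and `M` a finitely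
generated `R`-module. Then `Ext^i_R(M, R/a) = 0` for all `i ≫ 0` iff
`Tor_i^R(M, R/a) = 0` for all `i ≫ 0`. -/
theorem stmt_14 (R : Type) [CommRing R] [IsLocalRing R] (hR : IsGorensteinLocalRing R)
    (a : Ideal R) (ha : IsGorensteinLocalRing (R ⧸ a))
    (M : Type) [AddCommGroup M] [Module R M] [Module.Finite R M] :
    (∃ n₀ : ℕ, ∀ i : ℕ, n₀ ≤ i →
      IsZero (ExtMod R i (ModuleCat.of R M) (ModuleCat.of R (R ⧸ a)))) ↔
    (∃ n₀ : ℕ, ∀ i : ℕ, n₀ ≤ i →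
      IsZero (TorMod R i (ModuleCat.of R M) (ModuleCat.of R (R ⧸ a)))) := by
  have := hR.2.1
  obtain ⟨d, h1, h2⟩ := injDim_PDec_PInc ha.2.2
  let A : FGM R := { K := M }
  refine (eventually_shift _ _ (fun k => isZero_ext_iff' (S := R ⧸ a) A k)).trans
    (Iff.trans ?_ (eventually_shift _ _ (fun k => isZero_tor_iff' (S := R ⧸ a) A k)).symm)
  exact dual_exact_iff d h1 h2 (G := fun k => TensorProduct R (R ⧸ a) (A.F k))
    (fun k => (A.d k).baseChange (R ⧸ a)) (fun k => by
      rw [← LinearMap.baseChange_comp, (A.exact_succ k).linearMap_comp_eq_zero,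
        LinearMap.baseChange_zero])

end
end

section
/- Let R be a Gorenstein local ring and let a and b be Gorenstein ideals of R. Then the following are equivalent: (i) Ext^i_R(R/a, R/b) = 0 for all i ≫ 0; (ii) Ext^i_R(R/b, R/a) = 0 for all i ≫ 0; (iii) Tor_i^R(R/a, R/b) = 0 for all i ≫ 0. -/
open CategoryTheory CategoryTheory.Limits CategoryTheory.MonoidalCategory Opposite

noncomputable section

universe u

variable (R : Type u) [CommRing R]

/-- Elementary data of a resolution by finite free modules with given syzygies. -/
structure SyzRes (R : Type u) [CommRing R] (K : ℕ → ModuleCat.{u} R) where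
  b : ℕ → ℕ
  p : ∀ n, (Fin (b n) → R) →ₗ[R] K n
  j : ∀ n, K (n + 1) →ₗ[R] (Fin (b n) → R)
  p_surj : ∀ n, Function.Surjective (p n)
  j_inj : ∀ n, Function.Injective (j n)
  exact : ∀ n, Function.Exact (j n) (p n)

namespace SyzRes

variable {R : Type u} [CommRing R] {K : ℕ → ModuleCat.{u} R} (P : SyzRes R K)

/-- The differential. -/
def d (n : ℕ) : (Fin (P.b (n + 1)) → R) →ₗ[R] (Fin (P.b n) → R) := P.j n ∘ₗ P.p (n + 1)

lemma exact0 : Function.Exact (P.d 0) (P.p 0) := by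
  intro x
  rw [P.exact 0 x]
  constructor
  · rintro ⟨y, rfl⟩
    obtain ⟨z, rfl⟩ := P.p_surj 1 y
    exact ⟨z, rfl⟩
  · rintro ⟨z, rfl⟩
    exact ⟨_, rfl⟩

lemma exact_d (n : ℕ) : Function.Exact (P.d (n + 1)) (P.d n) := by
  intro x
  have h1 : P.d n x = 0 ↔ P.p (n + 1) x = 0 := by
    show P.j n (P.p (n + 1) x) = 0 ↔ _
    rw [← (P.j n).map_zero]
    exact (P.j_inj n).eq_iff
  rw [h1, P.exact (n + 1) x]
  constructor
  · rintro ⟨y, rfl⟩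
    obtain ⟨z, rfl⟩ := P.p_surj (n + 2) y
    exact ⟨z, rfl⟩
  · rintro ⟨z, rfl⟩
    exact ⟨_, rfl⟩

lemma d_comp_d (n : ℕ) : P.d n ∘ₗ P.d (n + 1) = 0 := by
  ext1 x
  exact (P.exact_d n).linearMap_comp_eq_zero ▸ rfl

/-- The chain complex. -/
def cx : ChainComplex (ModuleCat.{u} R) ℕ :=
  ChainComplex.of (fun n => ModuleCat.of R (Fin (P.b n) → R)) (fun n => ModuleCat.ofHom (P.d n))
    (fun n => by
      rw [← ModuleCat.ofHom_comp, (P.exact_d n).linearMap_comp_eq_zero]; rfl)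

lemma cx_d (n : ℕ) : P.cx.d (n + 1) n = ModuleCat.ofHom (P.d n) := by
  unfold cx
  exact ChainComplex.of_d (fun n => ModuleCat.of R (Fin (P.b n) → R))
    (fun n => ModuleCat.ofHom (P.d n)) n

lemma cx_exactAt (n : ℕ) : P.cx.ExactAt (n + 1) := by
  rw [HomologicalComplex.exactAt_iff' _ (n + 1 + 1) (n + 1) n (by simp) (by simp)]
  rw [ShortComplex.ShortExact.moduleCat_exact_iff_function_exact]
  have := P.exact_d n
  dsimp [HomologicalComplex.sc', HomologicalComplex.shortComplexFunctor']
  rw [P.cx_d, P.cx_d]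
  exact this

/-- The associated projective resolution. -/
def projRes : ProjectiveResolution (K 0) where
  complex := P.cx
  projective n := by
    have : Projective (ModuleCat.of R (Fin (P.b n) → R)) :=
      (IsProjective.iff_projective (R := R) (Fin (P.b n) → R)).1 inferInstance
    exact this
  π := (ChainComplex.toSingle₀Equiv _ _).symm ⟨ModuleCat.ofHom (P.p 0), by
          rw [cx_d]
          erw [← ModuleCat.ofHom_comp, P.exact0.linearMap_comp_eq_zero]; rfl⟩
  quasiIso := ⟨fun n => by
    cases n
    · rw [ChainComplex.quasiIsoAt₀_iff, ShortComplex.quasiIso_iff_of_zeros']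
      · have hex : (ShortComplex.mk (ModuleCat.ofHom (P.d 0)) (ModuleCat.ofHom (P.p 0)) (by
          rw [← ModuleCat.ofHom_comp, P.exact0.linearMap_comp_eq_zero]; rfl)).Exact := by
          rw [ShortComplex.ShortExact.moduleCat_exact_iff_function_exact]
          exact P.exact0
        refine (ShortComplex.exact_and_epi_g_iff_of_iso ?_).2
          ⟨hex, (ModuleCat.epi_iff_surjective _).2 (P.p_surj 0)⟩
        refine ShortComplex.isoMk (Iso.refl _) (Iso.refl _) (Iso.refl _) ?_ ?_
        · simp [cx_d]
          rfl
        · simp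
          rfl
      all_goals rfl
    · rw [quasiIsoAt_iff_exactAt']
      · apply cx_exactAt
      · apply ChainComplex.exactAt_succ_single_obj⟩

lemma tor_iff (N : ModuleCat.{u} R) (i : ℕ) :
    IsZero (TorMod R (i + 1) N (K 0)) ↔
      Function.Exact (LinearMap.lTensor N (P.d (i + 1))) (LinearMap.lTensor N (P.d i)) := by
  have e := P.projRes.isoLeftDerivedObj ((tensoringLeft (ModuleCat.{u} R)).obj N) (i + 1)
  have h1 : IsZero (TorMod R (i + 1) N (K 0)) ↔
    IsZero ((HomologicalComplex.homologyFunctor (ModuleCat R) (ComplexShape.down ℕ) (i + 1)).obj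
      ((((tensoringLeft (ModuleCat R)).obj N).mapHomologicalComplex (ComplexShape.down ℕ)).obj
          P.projRes.complex)) := ⟨fun h => h.of_iso e.symm, fun h => h.of_iso e⟩
  rw [h1]
  change IsZero (HomologicalComplex.homology _ (i + 1)) ↔ _
  rw [← HomologicalComplex.exactAt_iff_isZero_homology,
    HomologicalComplex.exactAt_iff' _ (i + 1 + 1) (i + 1) i (by simp) (by simp),
    ShortComplex.ShortExact.moduleCat_exact_iff_function_exact]
  change Function.Exact (LinearMap.lTensor N (P.cx.d (i + 1 + 1) (i + 1)).hom)
    (LinearMap.lTensor N (P.cx.d (i + 1) i).hom) ↔ _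
  rw [P.cx_d, P.cx_d]
  rfl

lemma ext_iff (N : ModuleCat.{u} R) (i : ℕ) :
    IsZero (ExtMod R (i + 1) (K 0) N) ↔
      ∀ f : (Fin (P.b (i + 1)) → R) →ₗ[R] N, f ∘ₗ P.d (i + 1) = 0 →
        ∃ g : (Fin (P.b i) → R) →ₗ[R] N, g ∘ₗ P.d i = f := by
  have e := P.projRes.isoExt (R := R) (i + 1) N
  have h1 : IsZero (ExtMod R (i + 1) (K 0) N) ↔ IsZero
    ((P.projRes.complex.linearYonedaObj R N).homology (i + 1)) :=
    ⟨fun h => h.of_iso e.symm, fun h => h.of_iso e⟩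
  rw [h1, ← HomologicalComplex.exactAt_iff_isZero_homology,
    HomologicalComplex.exactAt_iff' _ i (i + 1) (i + 1 + 1) (by simp) (by simp),
    ShortComplex.moduleCat_exact_iff]
  constructor
  · intro h f hf
    obtain ⟨g, hg⟩ := h (show P.cx.X (i + 1) ⟶ N from ModuleCat.ofHom f) (by
      show P.cx.d (i + 1 + 1) (i + 1) ≫ ModuleCat.ofHom f = 0
      rw [P.cx_d]
      erw [← ModuleCat.ofHom_comp, hf]; rfl)
    have hg' : P.cx.d (i + 1) i ≫ (show P.cx.X i ⟶ N from g) = ModuleCat.ofHom f := hg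
    rw [P.cx_d] at hg'
    exact ⟨ModuleCat.Hom.hom (show P.cx.X i ⟶ N from g), congrArg ModuleCat.Hom.hom hg'⟩
  · intro h f hf
    have hf' : P.cx.d (i + 1 + 1) (i + 1) ≫ (show P.cx.X (i + 1) ⟶ N from f) = 0 := hf
    rw [P.cx_d] at hf'
    obtain ⟨g, hg⟩ := h (ModuleCat.Hom.hom (show P.cx.X (i + 1) ⟶ N from f))
      (congrArg ModuleCat.Hom.hom hf')
    refine ⟨(show P.cx.X i ⟶ N from ModuleCat.ofHom g), ?_⟩
    show P.cx.d (i + 1) i ≫ ModuleCat.ofHom g = (show P.cx.X (i + 1) ⟶ N from f)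
    rw [P.cx_d]
    apply ModuleCat.hom_ext
    exact hg

end SyzRes

/-- A chosen finite free cover. -/
lemma exists_cover (R : Type u) [CommRing R] (M : ModuleCat.{u} R) [Module.Finite R M] :
    ∃ (n : ℕ) (p : (Fin n → R) →ₗ[R] M), Function.Surjective p :=
  Module.Finite.exists_fin' R M

/-- Iterated syzygies together with finiteness. -/
def syzAux (R : Type u) [CommRing R] [IsNoetherianRing R]
    (M : {M : ModuleCat.{u} R // Module.Finite R M}) :
    ℕ → {M : ModuleCat.{u} R // Module.Finite R M}
  | 0 => M
  | n + 1 =>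
    let N := syzAux R M n
    haveI := N.2
    ⟨ModuleCat.of R (LinearMap.ker (exists_cover R N.1).choose_spec.choose),
      Module.Finite.of_fg (IsNoetherian.noetherian _)⟩

/-- The sequence of syzygies has a `SyzRes` structure. -/
def syzRes (R : Type u) [CommRing R] [IsNoetherianRing R]
    (M : {M : ModuleCat.{u} R // Module.Finite R M}) : SyzRes R (fun n => (syzAux R M n).1) where
  b n := haveI := (syzAux R M n).2; (exists_cover R (syzAux R M n).1).choose
  p n := haveI := (syzAux R M n).2; (exists_cover R (syzAux R M n).1).choose_spec.choose
  j n := haveI := (syzAux R M n).2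
    (LinearMap.ker (exists_cover R (syzAux R M n).1).choose_spec.choose).subtype
  p_surj n := haveI := (syzAux R M n).2
    (exists_cover R (syzAux R M n).1).choose_spec.choose_spec
  j_inj _ := Subtype.val_injective
  exact n := haveI := (syzAux R M n).2
    LinearMap.exact_subtype_ker_map (exists_cover R (syzAux R M n).1).choose_spec.choose

section Chase

variable {R : Type u} [CommRing R]
  {A2 A1 A0 B3 B2 B1 B0 C3 C2 C1 : Type u}
  [AddCommGroup A2] [AddCommGroup A1] [AddCommGroup A0]
  [AddCommGroup B3] [AddCommGroup B2] [AddCommGroup B1] [AddCommGroup B0]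
  [AddCommGroup C3] [AddCommGroup C2] [AddCommGroup C1]
  [Module R A2] [Module R A1] [Module R A0]
  [Module R B3] [Module R B2] [Module R B1] [Module R B0]
  [Module R C3] [Module R C2] [Module R C1]

lemma chase1 (dA2 : A2 →ₗ[R] A1)
    (dB3 : B3 →ₗ[R] B2) (dB2 : B2 →ₗ[R] B1) (dB1 : B1 →ₗ[R] B0)
    (dC3 : C3 →ₗ[R] C2) (dC2 : C2 →ₗ[R] C1)
    (a2 : A2 →ₗ[R] B2) (a1 : A1 →ₗ[R] B1)
    (q3 : B3 →ₗ[R] C3) (q2 : B2 →ₗ[R] C2) (q1 : B1 →ₗ[R] C1)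
    (sA2 : ∀ x, dB2 (a2 x) = a1 (dA2 x))
    (sB3 : ∀ x, dC3 (q3 x) = q2 (dB3 x)) (sB2 : ∀ x, dC2 (q2 x) = q1 (dB2 x))
    (ea2 : Function.Exact a2 q2) (ea1 : Function.Exact a1 q1)
    (ia1 : Function.Injective a1) (sq3 : Function.Surjective q3)
    (eB1 : Function.Exact dB2 dB1) (eB2 : Function.Exact dB3 dB2)
    (eC : ∀ z, dC2 z = 0 → ∃ t, dC3 t = z)
    (x : A1) (hx : dB1 (a1 x) = 0) : ∃ w, dA2 w = x := by
  obtain ⟨y, hy⟩ := (eB1 _).1 hx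
  obtain ⟨t', ht'⟩ := eC (q2 y) (by rw [sB2, hy]; exact (ea1 _).2 ⟨x, rfl⟩)
  obtain ⟨t, rfl⟩ := sq3 t'
  obtain ⟨w, hw⟩ := (ea2 (y - dB3 t)).1 (by rw [map_sub, ← sB3, ht', sub_self])
  refine ⟨w, ia1 ?_⟩
  rw [← sA2, hw, map_sub, hy, (eB2 (dB3 t)).2 ⟨t, rfl⟩, sub_zero]

lemma chase2 (dA2 : A2 →ₗ[R] A1) (dA1 : A1 →ₗ[R] A0)
    (dB3 : B3 →ₗ[R] B2) (dB2 : B2 →ₗ[R] B1) (dB1 : B1 →ₗ[R] B0)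
    (dC3 : C3 →ₗ[R] C2) (dC2 : C2 →ₗ[R] C1)
    (a2 : A2 →ₗ[R] B2) (a1 : A1 →ₗ[R] B1) (a0 : A0 →ₗ[R] B0)
    (q3 : B3 →ₗ[R] C3) (q2 : B2 →ₗ[R] C2) (q1 : B1 →ₗ[R] C1)
    (sA2 : ∀ x, dB2 (a2 x) = a1 (dA2 x)) (sA1 : ∀ x, dB1 (a1 x) = a0 (dA1 x))
    (sB3 : ∀ x, dC3 (q3 x) = q2 (dB3 x)) (sB2 : ∀ x, dC2 (q2 x) = q1 (dB2 x))
    (ea2 : Function.Exact a2 q2) (ea1 : Function.Exact a1 q1)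
    (ia0 : Function.Injective a0) (sq2 : Function.Surjective q2)
    (eB1 : Function.Exact dB2 dB1) (eB2 : Function.Exact dB3 dB2)
    (eA : ∀ z, dA1 z = 0 → ∃ t, dA2 t = z)
    (z : C2) (hz : dC2 z = 0) : ∃ t, dC3 t = z := by
  obtain ⟨z, rfl⟩ := sq2 z
  rw [sB2] at hz
  obtain ⟨x, hx⟩ := (ea1 _).1 hz
  obtain ⟨w, hw⟩ := eA x (ia0 (by
    rw [← sA1, hx, map_zero]; exact (eB1 _).2 ⟨z, rfl⟩))
  obtain ⟨t, ht⟩ := (eB2 (z - a2 w)).1 (by rw [map_sub, sA2, hw, hx, sub_self])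
  refine ⟨q3 t, ?_⟩
  rw [sB3, ht, map_sub, (ea2 (a2 w)).2 ⟨w, rfl⟩, sub_zero]

end Chase

section Balance

open TensorProduct

variable {R : Type u} [CommRing R]

lemma exact_iff_of_comp {A B C : Type u} [AddCommGroup A] [AddCommGroup B] [AddCommGroup C]
    [Module R A] [Module R B] [Module R C] (f : A →ₗ[R] B) (g : B →ₗ[R] C)
    (h : g ∘ₗ f = 0) : Function.Exact f g ↔ ∀ z, g z = 0 → ∃ t, f t = z := by
  constructor
  · intro H z hz
    exact (H z).1 hz
  · intro H z
    refine ⟨fun hz => H z hz, ?_⟩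
    rintro ⟨t, rfl⟩
    exact LinearMap.congr_fun h t

lemma lr_comm {K G F F' : Type u} [AddCommGroup K] [AddCommGroup G] [AddCommGroup F]
    [AddCommGroup F'] [Module R K] [Module R G] [Module R F] [Module R F']
    (a : K →ₗ[R] G) (d : F →ₗ[R] F') (x : K ⊗[R] F) :
    LinearMap.lTensor G d (LinearMap.rTensor F a x) =
      LinearMap.rTensor F' a (LinearMap.lTensor K d x) := by
  rw [← LinearMap.comp_apply, ← LinearMap.comp_apply, LinearMap.lTensor_comp_rTensor,
    LinearMap.rTensor_comp_lTensor]

namespace SyzRes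

variable {K : ℕ → ModuleCat.{u} R} (P : SyzRes R K) {L : ℕ → ModuleCat.{u} R} (Q : SyzRes R L)

/-- Exactness of `X ⊗ P` in degree `i + 1`. -/
def EX (X : Type u) [AddCommGroup X] [Module R X] (i : ℕ) : Prop :=
  Function.Exact (LinearMap.lTensor X (P.d (i + 1))) (LinearMap.lTensor X (P.d i))

lemma EX_iff (X : Type u) [AddCommGroup X] [Module R X] (i : ℕ) :
    P.EX X i ↔ ∀ z, LinearMap.lTensor X (P.d i) z = 0 →
      ∃ t, LinearMap.lTensor X (P.d (i + 1)) t = z :=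
  exact_iff_of_comp _ _ (by
    rw [← LinearMap.lTensor_comp, (P.exact_d i).linearMap_comp_eq_zero, LinearMap.lTensor_zero])

lemma EX_free (n i : ℕ) : P.EX (Fin n → R) i :=
  Module.Flat.lTensor_exact _ (P.exact_d i)

lemma rTensor_inj (n m : ℕ) : Function.Injective (LinearMap.rTensor (Fin m → R) (Q.j n)) :=
  Module.Flat.rTensor_preserves_injective_linearMap _ (Q.j_inj n)

lemma EX_shift (Q : SyzRes R L) (n i : ℕ) : P.EX (L n) (i + 1) ↔ P.EX (L (n + 1)) i := by
  have e0 : Function.Exact (LinearMap.lTensor (Fin (Q.b n) → R) (P.d (i + 1)))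
    (LinearMap.lTensor _ (P.d i)) := P.EX_free _ i
  have e2 : Function.Exact (LinearMap.lTensor (Fin (Q.b n) → R) (P.d (i + 2)))
    (LinearMap.lTensor _ (P.d (i + 1))) := P.EX_free _ (i + 1)
  rw [EX_iff, EX_iff]
  constructor
  · intro H x hx
    refine chase1 _ (LinearMap.lTensor _ (P.d (i + 2))) (LinearMap.lTensor _ (P.d (i + 1)))
      (LinearMap.lTensor _ (P.d i)) _ _
      (LinearMap.rTensor _ (Q.j n)) (LinearMap.rTensor _ (Q.j n))
      (LinearMap.rTensor _ (Q.p n)) (LinearMap.rTensor _ (Q.p n)) (LinearMap.rTensor _ (Q.p n))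
      (fun x => lr_comm _ _ x) (fun x => lr_comm _ _ x) (fun x => lr_comm _ _ x)
      (rTensor_exact _ (Q.exact n) (Q.p_surj n)) (rTensor_exact _ (Q.exact n) (Q.p_surj n))
      (Q.rTensor_inj n _) (LinearMap.rTensor_surjective _ (Q.p_surj n))
      e0 e2 H x ?_
    rw [lr_comm, hx, map_zero]
  · intro H
    exact chase2 _ _ (LinearMap.lTensor _ (P.d (i + 2))) (LinearMap.lTensor _ (P.d (i + 1)))
      (LinearMap.lTensor _ (P.d i)) _ _
      (LinearMap.rTensor _ (Q.j n)) (LinearMap.rTensor _ (Q.j n)) (LinearMap.rTensor _ (Q.j n))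
      (LinearMap.rTensor _ (Q.p n)) (LinearMap.rTensor _ (Q.p n)) (LinearMap.rTensor _ (Q.p n))
      (fun x => lr_comm _ _ x) (fun x => lr_comm _ _ x) (fun x => lr_comm _ _ x)
      (fun x => lr_comm _ _ x)
      (rTensor_exact _ (Q.exact n) (Q.p_surj n)) (rTensor_exact _ (Q.exact n) (Q.p_surj n))
      (Q.rTensor_inj n _) (LinearMap.rTensor_surjective _ (Q.p_surj n))
      e0 e2 H

lemma EX_zero (n : ℕ) : P.EX (L n) 0 ↔ Function.Injective (LinearMap.rTensor (K 0) (Q.j n)) := by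
  have e0 : Function.Exact (LinearMap.lTensor (Fin (Q.b n) → R) (P.d 0))
    (LinearMap.lTensor _ (P.p 0)) := lTensor_exact _ P.exact0 (P.p_surj 0)
  have e2 : Function.Exact (LinearMap.lTensor (Fin (Q.b n) → R) (P.d 1))
    (LinearMap.lTensor _ (P.d 0)) := P.EX_free _ 0
  have e1 : Function.Exact (LinearMap.lTensor (L (n + 1)) (P.d 0))
    (LinearMap.lTensor _ (P.p 0)) := lTensor_exact _ P.exact0 (P.p_surj 0)
  rw [EX_iff]
  constructor
  · intro H
    rw [injective_iff_map_eq_zero]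
    intro x hx
    obtain ⟨x, rfl⟩ := LinearMap.lTensor_surjective _ (P.p_surj 0) x
    obtain ⟨w, rfl⟩ := chase1 (LinearMap.lTensor _ (P.d 0))
      (LinearMap.lTensor _ (P.d 1)) (LinearMap.lTensor _ (P.d 0))
      (LinearMap.lTensor _ (P.p 0)) _ _
      (LinearMap.rTensor _ (Q.j n)) (LinearMap.rTensor _ (Q.j n))
      (LinearMap.rTensor _ (Q.p n)) (LinearMap.rTensor _ (Q.p n)) (LinearMap.rTensor _ (Q.p n))
      (fun x => lr_comm _ _ x) (fun x => lr_comm _ _ x) (fun x => lr_comm _ _ x)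
      (rTensor_exact _ (Q.exact n) (Q.p_surj n)) (rTensor_exact _ (Q.exact n) (Q.p_surj n))
      (Q.rTensor_inj n _) (LinearMap.rTensor_surjective _ (Q.p_surj n))
      e0 e2 H x (by rw [lr_comm, hx])
    exact (e1 _).2 ⟨w, rfl⟩
  · intro H
    exact chase2 (LinearMap.lTensor (L (n + 1)) (P.d 0)) (LinearMap.lTensor (L (n + 1)) (P.p 0))
      (LinearMap.lTensor _ (P.d 1)) (LinearMap.lTensor _ (P.d 0))
      (LinearMap.lTensor _ (P.p 0)) _ _
      (LinearMap.rTensor _ (Q.j n)) (LinearMap.rTensor _ (Q.j n)) (LinearMap.rTensor _ (Q.j n))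
      (LinearMap.rTensor _ (Q.p n)) (LinearMap.rTensor _ (Q.p n)) (LinearMap.rTensor _ (Q.p n))
      (fun x => lr_comm _ _ x) (fun x => lr_comm _ _ x) (fun x => lr_comm _ _ x)
      (fun x => lr_comm _ _ x)
      (rTensor_exact _ (Q.exact n) (Q.p_surj n)) (rTensor_exact _ (Q.exact n) (Q.p_surj n))
      H (LinearMap.rTensor_surjective _ (Q.p_surj n))
      e0 e2 (fun z hz => (e1 z).1 hz)

lemma EX_iterate (Q : SyzRes R L) (n i : ℕ) : P.EX (L n) i ↔ P.EX (L (n + i)) 0 := by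
  induction i generalizing n with
  | zero => rfl
  | succ i ih => rw [EX_shift P Q, ih, show n + 1 + i = n + (i + 1) by omega]

lemma EX_inj (M : Type u) [AddCommGroup M] [Module R M] (i : ℕ) :
    Q.EX M i ↔ Function.Injective (LinearMap.lTensor M (Q.j i)) := by
  have e : Function.Exact (LinearMap.lTensor M (Q.j (i + 1))) (LinearMap.lTensor M (Q.p (i + 1))) :=
    lTensor_exact _ (Q.exact (i + 1)) (Q.p_surj (i + 1))
  have hd : ∀ i z, LinearMap.lTensor M (Q.d i) z =
      LinearMap.lTensor M (Q.j i) (LinearMap.lTensor M (Q.p (i + 1)) z) := by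
    intro i z
    rw [← LinearMap.comp_apply, ← LinearMap.lTensor_comp]
    rfl
  rw [EX_iff, injective_iff_map_eq_zero]
  constructor
  · intro H x hx
    obtain ⟨z, rfl⟩ := LinearMap.lTensor_surjective _ (Q.p_surj (i + 1)) x
    obtain ⟨t, rfl⟩ := H z (by rw [hd, hx])
    rw [hd]
    exact (e _).2 ⟨_, rfl⟩
  · intro H z hz
    rw [hd] at hz
    obtain ⟨x, rfl⟩ := (e z).1 (H _ hz)
    obtain ⟨t, rfl⟩ := LinearMap.lTensor_surjective _ (Q.p_surj (i + 2)) x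
    exact ⟨t, hd _ _⟩

lemma balance (i : ℕ) : P.EX (L 0) i ↔ Q.EX (K 0) i := by
  rw [EX_iterate P Q, EX_zero P Q, EX_inj, Nat.zero_add, ← LinearMap.lTensor_inj_iff_rTensor_inj]

end SyzRes

end Balance

section Dual

lemma lift_exact {S : Type u} [CommRing S] {P A B C : Type u} [AddCommGroup P] [AddCommGroup A]
    [AddCommGroup B] [AddCommGroup C] [Module S P] [Module S A] [Module S B] [Module S C]
    [Module.Projective S P] (f : A →ₗ[S] B) (g : B →ₗ[S] C) (h : Function.Exact f g)
    (k : P →ₗ[S] B) (hk : g ∘ₗ k = 0) : ∃ k' : P →ₗ[S] A, f ∘ₗ k' = k := by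
  obtain ⟨l, hl⟩ := Module.projective_lifting_property f.rangeRestrict
    (k.codRestrict (LinearMap.range f) (fun x => (h _).1 (LinearMap.congr_fun hk x)))
    f.surjective_rangeRestrict
  refine ⟨l, ?_⟩
  ext x
  exact congrArg Subtype.val (LinearMap.congr_fun hl x)

/-- One step of the extension argument. -/
lemma dual_step {S : Type u} [CommRing S] {A B C D I I' I'' : Type u}
    [AddCommGroup A] [AddCommGroup B] [AddCommGroup C] [AddCommGroup D]
    [AddCommGroup I] [AddCommGroup I'] [AddCommGroup I'']
    [Module S A] [Module S B] [Module S C] [Module S D]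
    [Module S I] [Module S I'] [Module S I''] [Module.Projective S D] [Module.Injective S I]
    (u₁ : A →ₗ[S] B) (v : B →ₗ[S] C) (w : C →ₗ[S] D) (e : I →ₗ[S] I') (e' : I' →ₗ[S] I'')
    (huv : Function.Exact u₁ v) (hvw : w ∘ₗ v = 0) (hI : Function.Exact e e')
    (IH : ∀ f' : C →ₗ[S] I', f' ∘ₗ v = 0 → e' ∘ₗ f' = 0 →
      ∃ g' : D →ₗ[S] I', g' ∘ₗ w = f' ∧ e' ∘ₗ g' = 0)
    (f : B →ₗ[S] I) (hf : f ∘ₗ u₁ = 0) (hef : e ∘ₗ f = 0) :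
    ∃ g : C →ₗ[S] I, g ∘ₗ v = f ∧ e ∘ₗ g = 0 := by
  have hle : LinearMap.ker v ≤ LinearMap.ker f := by
    intro x hx
    obtain ⟨y, rfl⟩ := (huv x).1 hx
    exact LinearMap.congr_fun hf y
  obtain ⟨g₀, hg₀⟩ := Module.Injective.out ((LinearMap.ker v).liftQ v le_rfl)
    (LinearMap.ker_eq_bot.1 (Submodule.ker_liftQ_eq_bot' _ _ rfl))
    ((LinearMap.ker v).liftQ f hle)
  have hg : g₀ ∘ₗ v = f := by
    ext x
    simpa using hg₀ (Submodule.Quotient.mk x)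
  obtain ⟨h, hh, hh'⟩ := IH (e ∘ₗ g₀) (by rw [LinearMap.comp_assoc, hg, hef])
    (by rw [← LinearMap.comp_assoc, hI.linearMap_comp_eq_zero, LinearMap.zero_comp])
  obtain ⟨h', rfl⟩ := lift_exact e e' hI h hh'
  refine ⟨g₀ - h' ∘ₗ w, ?_, ?_⟩
  · rw [LinearMap.sub_comp, LinearMap.comp_assoc, hvw, LinearMap.comp_zero, hg, sub_zero]
  · rw [LinearMap.comp_sub, ← LinearMap.comp_assoc, hh, sub_self]

variable {S : Type u} [CommRing S]

/-- Elementary form of finite injective dimension. -/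
lemma injdim_elim (n : ℕ) (h : InjDimLE S (ModuleCat.of S S) n) :
    ∃ (I : ℕ → ModuleCat.{u} S) (e : ∀ i, I i →ₗ[S] I (i + 1)) (ι : S →ₗ[S] I 0),
      (∀ i, Module.Injective S (I i)) ∧ (∀ i, n < i → Subsingleton (I i)) ∧
      Function.Injective ι ∧ Function.Exact ι (e 0) ∧
      ∀ i, Function.Exact (e i) (e (i + 1)) := by
  obtain ⟨I, ι, h1, h2, h3, ⟨w, h4⟩, h5⟩ := h
  refine ⟨I.X, fun i => (I.d i (i + 1)).hom, ι.hom, ?_, ?_, ?_, ?_, ?_⟩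
  · intro i
    haveI : Injective (ModuleCat.of S (I.X i)) := h1 i
    exact Module.injective_module_of_injective_object S (I.X i)
  · intro i hi
    exact ModuleCat.subsingleton_of_isZero (h2 i hi)
  · exact (ModuleCat.mono_iff_injective ι).1 h3
  · exact (ShortComplex.ShortExact.moduleCat_exact_iff_function_exact _).1 h4
  · intro i
    have := h5 (i + 1) (Nat.succ_pos i)
    rw [HomologicalComplex.exactAt_iff' _ i (i + 1) (i + 1 + 1) (by simp) (by simp),
      ShortComplex.ShortExact.moduleCat_exact_iff_function_exact] at this
    exact this

variable {C : ℕ → Type u} [∀ i, AddCommGroup (C i)] [∀ i, Module S (C i)]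
  [∀ i, Module.Projective S (C i)]

/-- Extension along a complex with increasing indices. -/
lemma asc_claim (n : ℕ) (hS : InjDimLE S (ModuleCat.of S S) n)
    (δ : ∀ i, C i →ₗ[S] C (i + 1)) (N : ℕ)
    (hδ : ∀ i, N ≤ i → Function.Exact (δ i) (δ (i + 1))) (m : ℕ) (hm : N ≤ m)
    (f : C (m + 1) →ₗ[S] S) (hf : f ∘ₗ δ m = 0) :
    ∃ g : C (m + 2) →ₗ[S] S, g ∘ₗ δ (m + 1) = f := by
  obtain ⟨I, e, ι, h1, h2, h3, h4, h5⟩ := injdim_elim n hS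
  have key : ∀ k j m : ℕ, n + 1 ≤ j + k → N ≤ m → ∀ f : C (m + 1) →ₗ[S] I j, f ∘ₗ δ m = 0 →
      e j ∘ₗ f = 0 → ∃ g : C (m + 2) →ₗ[S] I j, g ∘ₗ δ (m + 1) = f ∧ e j ∘ₗ g = 0 := by
    intro k
    induction k with
    | zero =>
      intro j m hj _ f _ _
      have := h2 j (by omega)
      exact ⟨0, LinearMap.ext fun x => Subsingleton.elim _ _, by simp⟩
    | succ k ih =>
      intro j m hj hm f hf hef
      have := h1 j
      exact dual_step (δ m) (δ (m + 1)) (δ (m + 2)) (e j) (e (j + 1)) (hδ m hm)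
        (hδ (m + 1) (by omega)).linearMap_comp_eq_zero (h5 j)
        (ih (j + 1) (m + 1) (by omega) (by omega)) f hf hef
  obtain ⟨g, hg, hg'⟩ := key (n + 1) 0 m (by omega) hm (ι ∘ₗ f)
    (by rw [LinearMap.comp_assoc, hf, LinearMap.comp_zero])
    (by rw [← LinearMap.comp_assoc, h4.linearMap_comp_eq_zero, LinearMap.zero_comp])
  obtain ⟨g, rfl⟩ := lift_exact _ _ h4 g hg'
  refine ⟨g, LinearMap.ext fun x => h3 (LinearMap.congr_fun hg x)⟩

/-- Extension along a complex with decreasing indices. -/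
lemma desc_claim (n : ℕ) (hS : InjDimLE S (ModuleCat.of S S) n)
    (D : ∀ i, C (i + 1) →ₗ[S] C i) (N : ℕ)
    (hD : ∀ i, N ≤ i → Function.Exact (D (i + 1)) (D i)) (m : ℕ) (hm : N + n + 1 ≤ m)
    (f : C (m + 1) →ₗ[S] S) (hf : f ∘ₗ D (m + 1) = 0) :
    ∃ g : C m →ₗ[S] S, g ∘ₗ D m = f := by
  obtain ⟨I, e, ι, h1, h2, h3, h4, h5⟩ := injdim_elim n hS
  have key : ∀ k j m : ℕ, n + 1 ≤ j + k → N + k ≤ m → ∀ f : C (m + 1) →ₗ[S] I j,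
      f ∘ₗ D (m + 1) = 0 →
      e j ∘ₗ f = 0 → ∃ g : C m →ₗ[S] I j, g ∘ₗ D m = f ∧ e j ∘ₗ g = 0 := by
    intro k
    induction k with
    | zero =>
      intro j m hj _ f _ _
      have := h2 j (by omega)
      exact ⟨0, LinearMap.ext fun x => Subsingleton.elim _ _, by simp⟩
    | succ k ih =>
      intro j m hj hm f hf hef
      have := h1 j
      obtain ⟨m, rfl⟩ : ∃ m', m = m' + 1 := ⟨m - 1, by omega⟩
      exact dual_step (D (m + 2)) (D (m + 1)) (D m) (e j) (e (j + 1)) (hD (m + 1) (by omega))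
        (hD m (by omega)).linearMap_comp_eq_zero (h5 j)
        (ih (j + 1) m (by omega) (by omega)) f hf hef
  obtain ⟨g, hg, hg'⟩ := key (n + 1) 0 m (by omega) (by omega) (ι ∘ₗ f)
    (by rw [LinearMap.comp_assoc, hf, LinearMap.comp_zero])
    (by rw [← LinearMap.comp_assoc, h4.linearMap_comp_eq_zero, LinearMap.zero_comp])
  obtain ⟨g, rfl⟩ := lift_exact _ _ h4 g hg'
  refine ⟨g, LinearMap.ext fun x => h3 (LinearMap.congr_fun hg x)⟩

/-- The duality statement for complexes of finite projective modules. -/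
lemma dual_iff [∀ i, Module.Finite S (C i)] (n : ℕ) (hS : InjDimLE S (ModuleCat.of S S) n)
    (D : ∀ i, C (i + 1) →ₗ[S] C i) (hDD : ∀ i, D i ∘ₗ D (i + 1) = 0) :
    (∃ N, ∀ i, N ≤ i → ∀ f : C (i + 1) →ₗ[S] S, f ∘ₗ D (i + 1) = 0 →
      ∃ g : C i →ₗ[S] S, g ∘ₗ D i = f) ↔
    (∃ N, ∀ i, N ≤ i → Function.Exact (D (i + 1)) (D i)) := by
  constructor
  · rintro ⟨N, hN⟩
    refine ⟨N, fun m hm => ?_⟩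
    intro x
    constructor
    · intro hx
      obtain ⟨g, hg⟩ := asc_claim (C := fun i => Module.Dual S (C i)) n hS
        (fun i => (D i).dualMap) N (by
          intro i hi f
          constructor
          · intro hf
            obtain ⟨g, hg⟩ := hN i hi f hf
            exact ⟨g, hg⟩
          · rintro ⟨g, rfl⟩
            show (g ∘ₗ D i) ∘ₗ D (i + 1) = 0
            rw [LinearMap.comp_assoc, hDD, LinearMap.comp_zero]) m hm
        (Module.Dual.eval S _ x) (by
          ext g
          show g (D m x) = 0
          rw [hx, map_zero])
      obtain ⟨y, rfl⟩ := (Module.bijective_dual_eval S (C (m + 2))).2 g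
      refine ⟨y, (Module.bijective_dual_eval S (C (m + 1))).1 ?_⟩
      rw [← hg]
      rfl
    · rintro ⟨y, rfl⟩
      exact LinearMap.congr_fun (hDD m) y
  · rintro ⟨N, hN⟩
    exact ⟨N + n + 1, fun m hm => desc_claim n hS D N hN m hm⟩

end Dual

namespace SyzRes

variable {R : Type u} [CommRing R] {K : ℕ → ModuleCat.{u} R} (P : SyzRes R K)

open TensorProduct in
lemma ext_iff_tor (S : Type u) [CommRing S] [Algebra R S]
    (hS : HasFiniteInjDim S (ModuleCat.of S S)) :
    (∃ n₀ : ℕ, ∀ i : ℕ, n₀ ≤ i → IsZero (ExtMod R i (K 0) (ModuleCat.of R S))) ↔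
    (∃ n₀ : ℕ, ∀ i : ℕ, n₀ ≤ i → P.EX S i) := by
  obtain ⟨n, hS⟩ := hS
  have h := dual_iff (C := fun i => S ⊗[R] (Fin (P.b i) → R)) n hS
    (fun i => (P.d i).baseChange S) (fun i => by
      rw [← LinearMap.baseChange_comp, (P.exact_d i).linearMap_comp_eq_zero,
        LinearMap.baseChange_zero])
  have h2 : (∃ n₀ : ℕ, ∀ i : ℕ, n₀ ≤ i → P.EX S i) ↔
      (∃ N, ∀ i, N ≤ i → Function.Exact ((P.d (i + 1)).baseChange S) ((P.d i).baseChange S)) :=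
    Iff.rfl
  rw [h2, ← h]
  have key : ∀ i, IsZero (ExtMod R (i + 1) (K 0) (ModuleCat.of R S)) ↔
      ∀ f : S ⊗[R] (Fin (P.b (i + 1)) → R) →ₗ[S] S, f ∘ₗ (P.d (i + 1)).baseChange S = 0 →
      ∃ g : S ⊗[R] (Fin (P.b i) → R) →ₗ[S] S, g ∘ₗ (P.d i).baseChange S = f := by
    intro i
    rw [P.ext_iff]
    constructor
    · intro H f hf
      obtain ⟨g, hg⟩ := H ((LinearMap.liftBaseChangeEquiv S).symm f) (by
        refine LinearMap.ext fun x => ?_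
        have := LinearMap.congr_fun hf (1 ⊗ₜ x)
        simpa using this)
      refine ⟨LinearMap.liftBaseChangeEquiv S g, ?_⟩
      apply (LinearMap.liftBaseChangeEquiv (R := R) S).symm.injective
      rw [← hg]
      ext x
      simp
    · intro H f hf
      have hf' : ∀ x, f (P.d (i + 1) x) = 0 := fun x => LinearMap.congr_fun hf x
      obtain ⟨g, hg⟩ := H (LinearMap.liftBaseChangeEquiv S f) (by
        apply (LinearMap.liftBaseChangeEquiv (R := R) S).symm.injective
        refine LinearMap.ext fun x => ?_
        simpa using hf' x)
      refine ⟨(LinearMap.liftBaseChangeEquiv S).symm g, ?_⟩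
      refine LinearMap.ext fun x => ?_
      have := LinearMap.congr_fun hg (1 ⊗ₜ x)
      simpa using this
  constructor
  · rintro ⟨N, hN⟩
    exact ⟨N, fun i hi => (key i).1 (hN (i + 1) (by omega))⟩
  · rintro ⟨N, hN⟩
    refine ⟨N + 1, fun i hi => ?_⟩
    obtain ⟨i, rfl⟩ : ∃ i', i = i' + 1 := ⟨i - 1, by omega⟩
    exact (key i).2 (hN i (by omega))

lemma tor_ev (N : ModuleCat.{u} R) :
    (∃ n₀ : ℕ, ∀ i : ℕ, n₀ ≤ i → IsZero (TorMod R i N (K 0))) ↔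
    (∃ n₀ : ℕ, ∀ i : ℕ, n₀ ≤ i → P.EX N i) := by
  constructor
  · rintro ⟨N, hN⟩
    exact ⟨N, fun i hi => (P.tor_iff _ i).1 (hN (i + 1) (by omega))⟩
  · rintro ⟨N, hN⟩
    refine ⟨N + 1, fun i hi => ?_⟩
    obtain ⟨i, rfl⟩ : ∃ i', i = i' + 1 := ⟨i - 1, by omega⟩
    exact (P.tor_iff _ i).2 (hN i (by omega))

end SyzRes

/-- Let `R` be a Gorenstein local ring and `a`, `b` Gorenstein ideals of `R`. The
following are equivalent: (i) `Ext^i_R(R/a, R/b) = 0` for `i ≫ 0`;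
(ii) `Ext^i_R(R/b, R/a) = 0` for `i ≫ 0`; (iii) `Tor_i^R(R/a, R/b) = 0` for `i ≫ 0`. -/
theorem stmt_15 (R : Type) [CommRing R] [IsLocalRing R] (hR : IsGorensteinLocalRing R)
    (a b : Ideal R) (ha : IsGorensteinLocalRing (R ⧸ a))
    (hb : IsGorensteinLocalRing (R ⧸ b)) :
    ((∃ n₀ : ℕ, ∀ i : ℕ, n₀ ≤ i →
      IsZero (ExtMod R i (ModuleCat.of R (R ⧸ a)) (ModuleCat.of R (R ⧸ b)))) ↔
    (∃ n₀ : ℕ, ∀ i : ℕ, n₀ ≤ i →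
      IsZero (ExtMod R i (ModuleCat.of R (R ⧸ b)) (ModuleCat.of R (R ⧸ a))))) ∧
    ((∃ n₀ : ℕ, ∀ i : ℕ, n₀ ≤ i →
      IsZero (ExtMod R i (ModuleCat.of R (R ⧸ b)) (ModuleCat.of R (R ⧸ a)))) ↔
    (∃ n₀ : ℕ, ∀ i : ℕ, n₀ ≤ i →
      IsZero (TorMod R i (ModuleCat.of R (R ⧸ a)) (ModuleCat.of R (R ⧸ b))))) := by
  haveI := hR.2.1
  have P := syzRes R ⟨ModuleCat.of R (R ⧸ a), (inferInstance : Module.Finite R (R ⧸ a))⟩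
  have Q := syzRes R ⟨ModuleCat.of R (R ⧸ b), (inferInstance : Module.Finite R (R ⧸ b))⟩
  have h1 := P.ext_iff_tor (R ⧸ b) hb.2.2
  have h2 := Q.ext_iff_tor (R ⧸ a) ha.2.2
  have h3 := Q.tor_ev (ModuleCat.of R (R ⧸ a))
  have hbal : ∀ i, P.EX (R ⧸ b) i ↔ Q.EX (R ⧸ a) i := fun i => SyzRes.balance P Q i
  simp only [hbal] at h1
  exact ⟨h1.trans h2.symm, h2.trans h3.symm⟩

end
end
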